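/- Let 0 < q < ∞, p = ∞, and 0 < u, v ≤ ∞. Then there exist constants c, C > 0 depending only on q, u, v such that for all n ∈ ℕ and all k ∈ ℕ: c · 2^{−k/n} n^{1/q} (log(n+1))^{−1/u} ≤ e_k(id: ℓ_{∞,u}^n → ℓ_{q,v}^n) ≤ C · 2^{−k/n} n^{1/q} (log(n+1))^{−1/u}. -/

import Mathlib

open scoped ENNReal Classical
open MeasureTheory

/-- The non-increasing rearrangement of `x : ℝ^n`: for `1 ≤ i ≤ n`,
`rearr n x i` is the `i`-th largest of the absolute values of the entries of `x`,
defined via `x_i^* = inf {t ≥ 0 : #{j : |x j| > t} ≤ i - 1}`. -/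
noncomputable def rearr (n : ℕ) (x : Fin n → ℝ) (i : ℕ) : ℝ :=
  sInf {t : ℝ | 0 ≤ t ∧ ((Finset.univ : Finset (Fin n)).filter (fun j => t < |x j|)).card ≤ i - 1}

/-- The Lorentz quasi-norm `‖x‖_{p,u}` on `ℝ^n` for `p, u ∈ (0,∞]`, with the
convention `1/∞ = 0`:  `‖x‖_{p,u} = (∑_{i=1}^n i^{u/p-1} (x_i^*)^u)^{1/u}` for `u < ∞`
and `‖x‖_{p,∞} = max_{1 ≤ i ≤ n} i^{1/p} x_i^*`. -/
noncomputable def lorentzNorm (n : ℕ) (p u : ℝ≥0∞) (x : Fin n → ℝ) : ℝ :=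
  if u = ⊤ then
    sSup {t : ℝ | ∃ i ∈ Finset.Icc 1 n, t = (i : ℝ) ^ (1 / p).toReal * rearr n x i}
  else
    (∑ i ∈ Finset.Icc 1 n, (i : ℝ) ^ ((u / p).toReal - 1) * rearr n x i ^ u.toReal) ^ (1 / u.toReal)

/-- The `k`-th (dyadic) entropy number of the identity map from `(ℝ^n, NX)` to `(ℝ^n, NY)`:
`e_k = inf {ε > 0 : ∃ y_1, …, y_{2^{k-1}} with B_X ⊆ ⋃ (y_i + ε B_Y)}`. -/
noncomputable def entropyNumber (n : ℕ) (NX NY : (Fin n → ℝ) → ℝ) (k : ℕ) : ℝ :=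
  sInf {ε : ℝ | 0 < ε ∧ ∃ T : Finset (Fin n → ℝ), T.card ≤ 2 ^ (k - 1) ∧
    ∀ x : Fin n → ℝ, NX x ≤ 1 → ∃ y ∈ T, NY (x - y) ≤ ε}

/-- The operator norm of the identity map from `(ℝ^n, NX)` to `(ℝ^n, NY)`:
`‖id‖ = sup {NY x : NX x ≤ 1}`. -/
noncomputable def opNorm (n : ℕ) (NX NY : (Fin n → ℝ) → ℝ) : ℝ :=
  sSup {t : ℝ | ∃ x : Fin n → ℝ, NX x ≤ 1 ∧ t = NY x}

theorem exists_perm_rearr (n : ℕ) (x : Fin n → ℝ) :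
    ∃ σ : Equiv.Perm (Fin n), Antitone (fun i => |x (σ i)|) ∧
      ∀ i : Fin n, rearr n x ((i : ℕ) + 1) = |x (σ i)| := by
  set σ := Tuple.sort (fun j => -|x j|) with hσ
  have hanti : Antitone (fun i => |x (σ i)|) := by
    intro i j hij
    have := Tuple.monotone_sort (fun j => -|x j|) hij
    simp only [Function.comp_apply, ← hσ] at this
    simpa using this
  refine ⟨σ, hanti, fun i => ?_⟩
  have hcard (t : ℝ) : (Finset.univ.filter (fun j => t < |x j|)).card =
      (Finset.univ.filter (fun j => t < |x (σ j)|)).card := by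
    symm
    rw [← Finset.card_map σ.toEmbedding]
    congr 1
    ext j
    simp only [Finset.mem_filter, Finset.mem_univ, true_and, Finset.mem_map_equiv]
    simp
  have hset : {t : ℝ | 0 ≤ t ∧ (Finset.univ.filter (fun j => t < |x j|)).card ≤
      (i : ℕ) + 1 - 1} = Set.Ici |x (σ i)| := by
    ext t
    simp only [Set.mem_ofPred_eq, Set.mem_Ici, Nat.add_sub_cancel]
    rw [hcard]
    constructor
    · rintro ⟨-, h⟩
      by_contra! hlt
      have hsub : Finset.Iic i ⊆ Finset.univ.filter (fun j => t < |x (σ j)|) := by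
        intro j hj
        simp only [Finset.mem_filter, Finset.mem_univ, true_and]
        exact hlt.trans_le (hanti (Finset.mem_Iic.1 hj))
      have := Finset.card_le_card hsub
      rw [Fin.card_Iic] at this
      omega
    · intro h
      refine ⟨(abs_nonneg _).trans h, ?_⟩
      have hsub : Finset.univ.filter (fun j => t < |x (σ j)|) ⊆ Finset.Iio i := by
        intro j hj
        simp only [Finset.mem_filter, Finset.mem_univ, true_and] at hj
        rw [Finset.mem_Iio]
        by_contra! hij
        exact absurd (hj.trans_le (hanti hij)) (not_lt.2 h)
      have := Finset.card_le_card hsub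
      rwa [Fin.card_Iio] at this
  rw [rearr, hset, csInf_Ici]

theorem rearr_nonneg (n : ℕ) (x : Fin n → ℝ) (i : ℕ) : 0 ≤ rearr n x i :=
  Real.sInf_nonneg fun _ h => h.1

theorem rearr_anti {n : ℕ} (x : Fin n → ℝ) {i j : ℕ} (hi : 1 ≤ i) (hij : i ≤ j) (hj : j ≤ n) :
    rearr n x j ≤ rearr n x i := by
  obtain ⟨σ, hanti, hσ⟩ := exists_perm_rearr n x
  have h1 := hσ ⟨i - 1, by omega⟩
  have h2 := hσ ⟨j - 1, by omega⟩
  simp only [Nat.sub_add_cancel hi, Nat.sub_add_cancel (hi.trans hij)] at h1 h2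
  rw [h1, h2]
  exact hanti (Fin.mk_le_mk.2 (by omega))

theorem rearr_le_of_forall {n : ℕ} {x : Fin n → ℝ} {a : ℝ} (h : ∀ j, |x j| ≤ a) {i : ℕ}
    (hi : i ∈ Finset.Icc 1 n) : rearr n x i ≤ a := by
  obtain ⟨σ, -, hσ⟩ := exists_perm_rearr n x
  rw [Finset.mem_Icc] at hi
  have h1 := hσ ⟨i - 1, by omega⟩
  simp only [Nat.sub_add_cancel hi.1] at h1
  rw [h1]
  exact h _

theorem sum_rearr {n : ℕ} (x : Fin n → ℝ) (f : ℝ → ℝ) :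
    ∑ i ∈ Finset.Icc 1 n, f (rearr n x i) = ∑ j, f |x j| := by
  obtain ⟨σ, -, hσ⟩ := exists_perm_rearr n x
  rw [← Equiv.sum_comp σ, ← Finset.sum_congr rfl fun i _ => congrArg f (hσ i),
    ← Finset.sum_range (fun i => f (rearr n x (i + 1))),
    Finset.range_eq_Ico, Finset.sum_Ico_add' (fun i => f (rearr n x i))]
  congr 1

theorem rpow_succ_sub_rpow_le {b : ℝ} (hb : 0 < b) (m : ℕ) :
    ((m + 1 : ℕ) : ℝ) ^ b - (m : ℝ) ^ b ≤ max 1 b * ((m + 1 : ℕ) : ℝ) ^ (b - 1) ∧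
      min 1 b * ((m + 1 : ℕ) : ℝ) ^ (b - 1) ≤ ((m + 1 : ℕ) : ℝ) ^ b - (m : ℝ) ^ b := by
  set y : ℝ := ((m + 1 : ℕ) : ℝ) with hy
  have hy1 : 1 ≤ y := by rw [hy]; push_cast; linarith [(Nat.cast_nonneg m : (0 : ℝ) ≤ m)]
  have hy0 : 0 < y := by linarith
  have hm : (m : ℝ) = y * (1 + -(1 / y)) := by rw [hy]; push_cast; field_simp; ring
  have hinv : 1 / y ≤ 1 := by rw [div_le_one hy0]; exact hy1
  have hinv0 : 0 ≤ 1 / y := by positivity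
  have hyb : y ^ b = y * y ^ (b - 1) := by
    rw [Real.rpow_sub hy0, Real.rpow_one]; field_simp
  have hmb : (m : ℝ) ^ b = y * y ^ (b - 1) * (1 + -(1 / y)) ^ b := by
    rw [hm, Real.mul_rpow hy0.le (by linarith), hyb]
  have hpos : 0 < y ^ (b - 1) := Real.rpow_pos_of_pos hy0 _
  have hkey : y * (1 - (1 + -(1 / y)) ^ b) ≤ max 1 b ∧ min 1 b ≤ y * (1 - (1 + -(1 / y)) ^ b) := by
    have hc1 : y * (b * (1 / y)) = b := by field_simp
    have hc2 : y * (1 / y) = 1 := by field_simp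
    rcases le_total b 1 with h | h
    · rw [max_eq_left h, min_eq_right h]
      have h1 := rpow_one_add_le_one_add_mul_self (s := -(1 / y)) (by linarith) hb.le h
      have h2 : 1 + -(1 / y) ≤ (1 + -(1 / y)) ^ b := by
        rcases (show (0:ℝ) ≤ 1 + -(1 / y) by linarith).eq_or_lt with h0 | h0
        · rw [← h0, Real.zero_rpow hb.ne']
        · simpa using Real.rpow_le_rpow_of_exponent_ge h0 (by linarith) h
      constructor <;> nlinarith
    · rw [max_eq_right h, min_eq_left h]
      have h1 := one_add_mul_self_le_rpow_one_add (s := -(1 / y)) (by linarith) h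
      have h2 : (1 + -(1 / y)) ^ b ≤ 1 + -(1 / y) := by
        rcases (show (0:ℝ) ≤ 1 + -(1 / y) by linarith).eq_or_lt with h0 | h0
        · rw [← h0, Real.zero_rpow hb.ne']
        · simpa using Real.rpow_le_rpow_of_exponent_ge h0 (by linarith) h
      constructor <;> nlinarith
  rw [hmb, hyb]
  constructor <;> nlinarith [hkey.1, hkey.2]

theorem rpow_le_sum_rpow_sub_one {b : ℝ} (hb : 0 < b) (n : ℕ) :
    (n : ℝ) ^ b ≤ max 1 b * ∑ i ∈ Finset.Icc 1 n, (i : ℝ) ^ (b - 1) := by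
  induction n with
  | zero => simp [Real.zero_rpow hb.ne']
  | succ m ih =>
    rw [Finset.sum_Icc_succ_top (by omega), mul_add]
    linarith [(rpow_succ_sub_rpow_le hb m).1]

theorem sum_rpow_sub_one_le {b : ℝ} (hb : 0 < b) (n : ℕ) :
    ∑ i ∈ Finset.Icc 1 n, (i : ℝ) ^ (b - 1) ≤ (min 1 b)⁻¹ * (n : ℝ) ^ b := by
  rw [inv_mul_eq_div, le_div_iff₀ (lt_min one_pos hb), mul_comm]
  induction n with
  | zero => simp [Real.zero_rpow hb.ne']
  | succ m ih =>
    rw [Finset.sum_Icc_succ_top (by omega), mul_add]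
    linarith [(rpow_succ_sub_rpow_le hb m).2]

theorem lorentzNorm_top (n : ℕ) (p : ℝ≥0∞) (x : Fin n → ℝ) :
    lorentzNorm n p ⊤ x =
      sSup {t : ℝ | ∃ i ∈ Finset.Icc 1 n, t = (i : ℝ) ^ (1 / p).toReal * rearr n x i} :=
  if_pos rfl

theorem lorentzNorm_of_ne_top (n : ℕ) (p : ℝ≥0∞) {u : ℝ≥0∞} (hu : u ≠ ⊤) (x : Fin n → ℝ) :
    lorentzNorm n p u x = (∑ i ∈ Finset.Icc 1 n,
      (i : ℝ) ^ (u.toReal * (1 / p).toReal - 1) * rearr n x i ^ u.toReal) ^ (1 / u.toReal) := by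
  rw [lorentzNorm, if_neg hu, ← ENNReal.toReal_mul, mul_one_div]

theorem rpow_mul_rearr_le_lorentzNorm_top {n : ℕ} (p : ℝ≥0∞) (x : Fin n → ℝ) {i : ℕ}
    (hi : i ∈ Finset.Icc 1 n) :
    (i : ℝ) ^ (1 / p).toReal * rearr n x i ≤ lorentzNorm n p ⊤ x := by
  rw [lorentzNorm_top]
  refine le_csSup ?_ ⟨i, hi, rfl⟩
  refine (((Finset.Icc 1 n).finite_toSet.image
    fun i : ℕ => (i : ℝ) ^ (1 / p).toReal * rearr n x i).subset ?_).bddAbove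
  rintro t ⟨j, hj, rfl⟩
  exact ⟨j, hj, rfl⟩

theorem lorentzNorm_top_le {n : ℕ} (hn : 0 < n) (p : ℝ≥0∞) (x : Fin n → ℝ) {t : ℝ}
    (h : ∀ i ∈ Finset.Icc 1 n, (i : ℝ) ^ (1 / p).toReal * rearr n x i ≤ t) :
    lorentzNorm n p ⊤ x ≤ t := by
  rw [lorentzNorm_top]
  refine csSup_le ⟨_, 1, Finset.mem_Icc.2 ⟨le_rfl, hn⟩, rfl⟩ ?_
  rintro _ ⟨j, hj, rfl⟩
  exact h j hj

theorem sum_mul_rearr_rpow_le {n : ℕ} (x : Fin n → ℝ) {V : ℝ} (hV : 0 < V) {w : ℕ → ℝ}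
    (hw : ∀ i, 0 ≤ w i) {i : ℕ} (hi : i ∈ Finset.Icc 1 n) :
    (∑ j ∈ Finset.Icc 1 i, w j) * rearr n x i ^ V ≤
      ∑ j ∈ Finset.Icc 1 n, w j * rearr n x j ^ V := by
  rw [Finset.mem_Icc] at hi
  rw [Finset.sum_mul]
  refine (Finset.sum_le_sum fun j hj => ?_).trans (Finset.sum_le_sum_of_subset_of_nonneg
    (Finset.Icc_subset_Icc_right hi.2) fun j _ _ => mul_nonneg (hw j)
      (Real.rpow_nonneg (rearr_nonneg _ _ _) _))
  rw [Finset.mem_Icc] at hj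
  exact mul_le_mul_of_nonneg_left (Real.rpow_le_rpow (rearr_nonneg _ _ _)
    (rearr_anti x hj.1 hj.2 hi.2) hV.le) (hw j)

theorem exists_rpow_mul_rearr_le_lorentzNorm (p v : ℝ≥0∞) (hp : 0 < (1 / p).toReal)
    (hv : 0 < v) : ∃ C : ℝ, 0 < C ∧ ∀ (n : ℕ) (x : Fin n → ℝ), ∀ i ∈ Finset.Icc 1 n,
      (i : ℝ) ^ (1 / p).toReal * rearr n x i ≤ C * lorentzNorm n p v x := by
  rcases eq_or_ne v ⊤ with rfl | hv'
  · exact ⟨1, one_pos, fun n x i hi => by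
      rw [one_mul]; exact rpow_mul_rearr_le_lorentzNorm_top p x hi⟩
  have hV : 0 < v.toReal := ENNReal.toReal_pos hv.ne' hv'
  set V := v.toReal
  set a := (1 / p).toReal
  have hM : 0 < max 1 (V * a) := lt_max_of_lt_left one_pos
  refine ⟨max 1 (V * a) ^ (1 / V), by positivity, fun n x i hi => ?_⟩
  have hx := rearr_nonneg n x i
  have hN : lorentzNorm n p v x = (∑ i ∈ Finset.Icc 1 n,
      (i : ℝ) ^ (V * a - 1) * rearr n x i ^ V) ^ (1 / V) := lorentzNorm_of_ne_top n p hv' x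
  rw [hN, ← Real.mul_rpow hM.le (Finset.sum_nonneg fun j _ =>
      mul_nonneg (by positivity) (Real.rpow_nonneg (rearr_nonneg _ _ _) _)), one_div V,
    Real.le_rpow_inv_iff_of_pos (by positivity) (mul_nonneg hM.le (Finset.sum_nonneg fun j _ =>
      mul_nonneg (by positivity) (Real.rpow_nonneg (rearr_nonneg _ _ _) _))) hV,
    Real.mul_rpow (by positivity) hx, ← Real.rpow_mul (Nat.cast_nonneg i), mul_comm a V]
  calc (i : ℝ) ^ (V * a) * rearr n x i ^ V
      ≤ (max 1 (V * a) * ∑ j ∈ Finset.Icc 1 i, (j : ℝ) ^ (V * a - 1)) * rearr n x i ^ V := by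
        gcongr
        exact rpow_le_sum_rpow_sub_one (by positivity) i
    _ ≤ _ := by
        rw [mul_assoc]
        gcongr
        exact sum_mul_rearr_rpow_le x hV (fun j => by positivity) hi

theorem exists_lorentzNorm_le_of_rpow_mul_rearr_le (p v : ℝ≥0∞) (hv : 0 < v) {γ : ℝ}
    (hγ : γ < (1 / p).toReal) : ∃ C : ℝ, 0 < C ∧ ∀ (n : ℕ) (x : Fin n → ℝ) (t : ℝ), 0 < n →
      0 ≤ t → (∀ i ∈ Finset.Icc 1 n, (i : ℝ) ^ γ * rearr n x i ≤ t) →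
        lorentzNorm n p v x ≤ C * ((n : ℝ) ^ ((1 / p).toReal - γ) * t) := by
  set a := (1 / p).toReal with ha
  rcases eq_or_ne v ⊤ with rfl | hv'
  · refine ⟨1, one_pos, fun n x t hn ht h => ?_⟩
    rw [one_mul]
    refine lorentzNorm_top_le hn p x fun i hi => ?_
    have hi' := Finset.mem_Icc.1 hi
    have hi0 : (0 : ℝ) < i := by exact_mod_cast hi'.1
    have hin : (i : ℝ) ≤ n := by exact_mod_cast hi'.2
    rw [← ha, show a = (a - γ) + γ by ring, Real.rpow_add hi0, mul_assoc]
    have hx := rearr_nonneg n x i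
    have hd : 0 ≤ a - γ := by linarith
    calc _ ≤ (n : ℝ) ^ (a - γ) * ((i : ℝ) ^ γ * rearr n x i) := by gcongr
      _ ≤ (n : ℝ) ^ (a - γ) * t := by gcongr; exact h i hi
      _ = _ := by ring_nf
  have hV : 0 < v.toReal := ENNReal.toReal_pos hv.ne' hv'
  set V := v.toReal
  have hb : 0 < V * (a - γ) := mul_pos hV (by linarith)
  have hm : 0 < (min 1 (V * (a - γ)))⁻¹ := inv_pos.2 (lt_min one_pos hb)
  refine ⟨(min 1 (V * (a - γ)))⁻¹ ^ (1 / V), by positivity, fun n x t hn ht h => ?_⟩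
  have hN : lorentzNorm n p v x = (∑ i ∈ Finset.Icc 1 n,
      (i : ℝ) ^ (V * a - 1) * rearr n x i ^ V) ^ (1 / V) := lorentzNorm_of_ne_top n p hv' x
  rw [hN, one_div V,
    Real.rpow_inv_le_iff_of_pos (Finset.sum_nonneg fun j _ =>
      mul_nonneg (by positivity) (Real.rpow_nonneg (rearr_nonneg _ _ _) _)) (by positivity) hV,
    Real.mul_rpow (by positivity) (by positivity), Real.mul_rpow (by positivity) ht,
    Real.rpow_inv_rpow hm.le hV.ne', ← Real.rpow_mul (Nat.cast_nonneg n), mul_comm (a - γ) V]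
  calc _ ≤ ∑ i ∈ Finset.Icc 1 n, (i : ℝ) ^ (V * (a - γ) - 1) * t ^ V := by
        refine Finset.sum_le_sum fun i hi => ?_
        have hi0 : (0 : ℝ) < i := by exact_mod_cast (Finset.mem_Icc.1 hi).1
        have hx := rearr_nonneg n x i
        rw [show V * a - 1 = (V * (a - γ) - 1) + γ * V by ring, Real.rpow_add hi0, mul_assoc,
          Real.rpow_mul hi0.le, ← Real.mul_rpow (by positivity) hx]
        gcongr
        exact h i hi
    _ = (∑ i ∈ Finset.Icc 1 n, (i : ℝ) ^ (V * (a - γ) - 1)) * t ^ V := by rw [Finset.sum_mul]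
    _ ≤ ((min 1 (V * (a - γ)))⁻¹ * (n : ℝ) ^ (V * (a - γ))) * t ^ V := by
        gcongr
        exact sum_rpow_sub_one_le hb n
    _ = _ := by ring

theorem rpow_mul_rearr_le_of_sum_rpow_le {n : ℕ} {x : Fin n → ℝ} {r t : ℝ} (hr : 0 < r)
    (ht : 0 ≤ t) (h : ∑ j, |x j| ^ r ≤ t ^ r) {i : ℕ} (hi : i ∈ Finset.Icc 1 n) :
    (i : ℝ) ^ (1 / r) * rearr n x i ≤ t := by
  have hx := rearr_nonneg n x i
  rw [← Real.rpow_le_rpow_iff (by positivity) ht hr, Real.mul_rpow (by positivity) hx,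
    ← Real.rpow_mul (Nat.cast_nonneg i), one_div_mul_cancel hr.ne', Real.rpow_one]
  have h1 := sum_mul_rearr_rpow_le x hr (w := fun _ => 1) (fun _ => zero_le_one) hi
  simp only [Finset.sum_const, Nat.card_Icc, Nat.add_sub_cancel, nsmul_eq_mul, mul_one,
    one_mul] at h1
  rw [sum_rearr x (fun y => y ^ r)] at h1
  exact h1.trans h

theorem sum_rpow_le_of_rpow_mul_rearr_le {n : ℕ} {x : Fin n → ℝ} {a t : ℝ} (ha : 0 < a)
    (ht : 0 ≤ t) (h : ∀ i ∈ Finset.Icc 1 n, (i : ℝ) ^ a * rearr n x i ≤ t) :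
    ∑ j, |x j| ^ (1 / (2 * a)) ≤ 2 * (n : ℝ) ^ (1 / 2 : ℝ) * t ^ (1 / (2 * a)) := by
  rw [← sum_rearr x (fun y => y ^ (1 / (2 * a)))]
  set s := 1 / (2 * a) with hs
  have hs0 : 0 < s := by positivity
  have has : a * s = 1 / 2 := by rw [hs]; field_simp
  calc _ ≤ ∑ i ∈ Finset.Icc 1 n, (i : ℝ) ^ ((1 / 2 : ℝ) - 1) * t ^ s := by
        refine Finset.sum_le_sum fun i hi => ?_
        have hi0 : (0 : ℝ) < i := by exact_mod_cast (Finset.mem_Icc.1 hi).1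
        have hx := rearr_nonneg n x i
        have h1 := Real.rpow_le_rpow (by positivity) (h i hi) hs0.le
        rw [Real.mul_rpow (by positivity) hx, ← Real.rpow_mul hi0.le, has] at h1
        rw [show (1 / 2 : ℝ) - 1 = -(1 / 2) by norm_num, Real.rpow_neg hi0.le, inv_mul_eq_div,
          le_div_iff₀ (by positivity), mul_comm]
        exact h1
    _ = (∑ i ∈ Finset.Icc 1 n, (i : ℝ) ^ ((1 / 2 : ℝ) - 1)) * t ^ s := by rw [Finset.sum_mul]
    _ ≤ _ := by
        gcongr
        have := sum_rpow_sub_one_le (b := 1 / 2) (by norm_num) n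
        rwa [show (min 1 (1 / 2 : ℝ))⁻¹ = 2 by norm_num] at this

theorem rearr_le_log_rpow_of_lorentzNorm_le_one {u : ℝ≥0∞} (hu : 0 < u) {n : ℕ} {x : Fin n → ℝ}
    (h : lorentzNorm n ⊤ u x ≤ 1) {i : ℕ} (hi : i ∈ Finset.Icc 1 n) :
    rearr n x i ≤ Real.log ((i : ℝ) + 1) ^ (-(1 / u).toReal) := by
  rcases eq_or_ne u ⊤ with rfl | hu'
  · simpa using (rpow_mul_rearr_le_lorentzNorm_top ⊤ x hi).trans h
  have hU : 0 < u.toReal := ENNReal.toReal_pos hu.ne' hu'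
  have hi1 : (1 : ℝ) ≤ i := by exact_mod_cast (Finset.mem_Icc.1 hi).1
  have hlog : 0 < Real.log ((i : ℝ) + 1) := Real.log_pos (by linarith)
  have hx := rearr_nonneg n x i
  rw [lorentzNorm_of_ne_top n ⊤ hu'] at h
  simp only [ENNReal.div_top, ENNReal.toReal_zero, mul_zero, zero_sub, ENNReal.toReal_div,
    ENNReal.toReal_one] at h ⊢
  set U := u.toReal
  rw [one_div, Real.rpow_inv_le_iff_of_pos (Finset.sum_nonneg fun j _ =>
      mul_nonneg (by positivity) (Real.rpow_nonneg (rearr_nonneg _ _ _) _)) zero_le_one hU,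
      Real.one_rpow] at h
  have h1 := (sum_mul_rearr_rpow_le x hU (w := fun j => (j : ℝ) ^ (-1 : ℝ))
    (fun j => by positivity) hi).trans h
  have h2 := log_add_one_le_harmonic i
  rw [harmonic_eq_sum_Icc] at h2
  push_cast at h2
  simp only [Real.rpow_neg_one] at h1
  have h3 : Real.log ((i : ℝ) + 1) * rearr n x i ^ U ≤ 1 :=
    (mul_le_mul_of_nonneg_right h2 (by positivity)).trans h1
  rw [← Real.rpow_le_rpow_iff hx (by positivity) hU, ← Real.rpow_mul hlog.le,
    show -(1 / U) * U = -1 by field_simp, Real.rpow_neg_one, ← one_div, le_div_iff₀ hlog, mul_comm]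
  exact h3

theorem lorentzNorm_le_one_of_forall_abs_le {u : ℝ≥0∞} (hu : 0 < u) {n : ℕ} (hn : 0 < n)
    {x : Fin n → ℝ}
    (h : ∀ j, |x j| ≤ (3 * Real.log ((n : ℝ) + 1)) ^ (-(1 / u).toReal)) :
    lorentzNorm n ⊤ u x ≤ 1 := by
  have hn1 : (1 : ℝ) ≤ n := by exact_mod_cast hn
  rcases eq_or_ne u ⊤ with rfl | hu'
  · refine lorentzNorm_top_le hn _ _ fun i hi => ?_
    simpa using rearr_le_of_forall h hi
  have hU : 0 < u.toReal := ENNReal.toReal_pos hu.ne' hu'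
  have hlog : 0 < Real.log ((n : ℝ) + 1) := Real.log_pos (by linarith)
  rw [lorentzNorm_of_ne_top n ⊤ hu']
  simp only [ENNReal.div_top, ENNReal.toReal_zero, mul_zero, zero_sub, ENNReal.toReal_div,
    ENNReal.toReal_one] at h ⊢
  set U := u.toReal
  rw [one_div, Real.rpow_inv_le_iff_of_pos (Finset.sum_nonneg fun j _ =>
      mul_nonneg (by positivity) (Real.rpow_nonneg (rearr_nonneg _ _ _) _)) zero_le_one hU,
      Real.one_rpow]
  calc _ ≤ ∑ i ∈ Finset.Icc 1 n, (i : ℝ)⁻¹ * (3 * Real.log ((n : ℝ) + 1))⁻¹ := by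
        refine Finset.sum_le_sum fun i hi => ?_
        rw [Real.rpow_neg_one]
        gcongr
        have := Real.rpow_le_rpow (rearr_nonneg n x i) (rearr_le_of_forall h hi) hU.le
        rwa [← Real.rpow_mul (by positivity), show -(1 / U) * U = -1 by field_simp,
          Real.rpow_neg_one] at this
    _ ≤ 1 := by
        rw [← Finset.sum_mul, ← div_eq_mul_inv, div_le_one (by positivity)]
        have h2 := harmonic_le_one_add_log n
        rw [harmonic_eq_sum_Icc] at h2
        push_cast at h2
        have h3 : Real.log n ≤ Real.log ((n : ℝ) + 1) := Real.log_le_log (by linarith) (by linarith)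
        have h4 : Real.log 2 ≤ Real.log ((n : ℝ) + 1) := Real.log_le_log (by norm_num) (by linarith)
        linarith [Real.log_two_gt_d9]

theorem log_add_one_le_mul_log_add_one {δ : ℝ} (hδ : 0 < δ) {i n : ℕ} (hi : i ∈ Finset.Icc 1 n) :
    Real.log ((n : ℝ) + 1) ≤ (1 + 2 / δ) * ((n / i : ℝ) ^ δ * Real.log ((i : ℝ) + 1)) := by
  rw [Finset.mem_Icc] at hi
  have hi1 : (1 : ℝ) ≤ i := by exact_mod_cast hi.1
  have hin : (i : ℝ) ≤ n := by exact_mod_cast hi.2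
  have hni : 1 ≤ (n / i : ℝ) := by rw [one_le_div (by linarith)]; exact hin
  have h1 : Real.log ((n : ℝ) + 1) ≤ Real.log (n / i) + Real.log (i + 1) := by
    rw [← Real.log_mul (by positivity) (by positivity)]
    refine Real.log_le_log (by linarith) ?_
    have : (n / i : ℝ) * (i + 1) = n + n / i := by field_simp
    linarith
  have h2 := Real.log_le_rpow_div (x := n / i) (by linarith) hδ
  have h3 : Real.log 2 ≤ Real.log ((i : ℝ) + 1) := Real.log_le_log (by norm_num) (by linarith)
  have h4 : 1 ≤ 2 * Real.log ((i : ℝ) + 1) := by linarith [Real.log_two_gt_d9]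
  have h5 : 1 ≤ (n / i : ℝ) ^ δ := Real.one_le_rpow hni hδ.le
  set L := Real.log ((i : ℝ) + 1)
  set P := (n / i : ℝ) ^ δ
  have h6 : P / δ ≤ P / δ * (2 * L) := le_mul_of_one_le_right (by positivity) h4
  have h7 : L ≤ P * L := le_mul_of_one_le_left (by linarith) h5
  have h8 : (1 + 2 / δ) * (P * L) = P * L + P / δ * (2 * L) := by ring
  linarith

theorem exists_sum_log_rpow_le {β : ℝ} (hβ : 0 ≤ β) : ∃ C : ℝ, 0 < C ∧ ∀ n : ℕ,
    ∑ i ∈ Finset.Icc 1 n, Real.log ((i : ℝ) + 1) ^ (-β) ≤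
      C * (n * Real.log ((n : ℝ) + 1) ^ (-β)) := by
  set δ : ℝ := 1 / (2 * (β + 1)) with hδ
  have hδ0 : 0 < δ := by positivity
  have hδβ : δ * β ≤ 1 / 2 := by
    rw [hδ, one_div_mul_eq_div, div_le_div_iff₀ (by positivity) (by norm_num)]
    linarith
  set D : ℝ := 1 + 2 / δ with hD
  have hD0 : 0 < D := by positivity
  refine ⟨2 * D ^ β, by positivity, fun n => ?_⟩
  calc _ ≤ ∑ i ∈ Finset.Icc 1 n, (D ^ β * Real.log ((n : ℝ) + 1) ^ (-β) * (n : ℝ) ^ (1 / 2 : ℝ)) *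
          (i : ℝ) ^ ((1 / 2 : ℝ) - 1) := by
        refine Finset.sum_le_sum fun i hi => ?_
        have h1 := log_add_one_le_mul_log_add_one hδ0 hi
        rw [Finset.mem_Icc] at hi
        have hi1 : (1 : ℝ) ≤ i := by exact_mod_cast hi.1
        have hin : (i : ℝ) ≤ n := by exact_mod_cast hi.2
        have hni : 1 ≤ (n / i : ℝ) := by rw [one_le_div (by linarith)]; exact hin
        have hLi : 0 < Real.log ((i : ℝ) + 1) := Real.log_pos (by linarith)
        have hLn : 0 < Real.log ((n : ℝ) + 1) := Real.log_pos (by linarith)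
        have h2 := Real.rpow_le_rpow hLn.le h1 hβ
        rw [Real.mul_rpow hD0.le (by positivity), Real.mul_rpow (by positivity) hLi.le,
          ← Real.rpow_mul (by positivity)] at h2
        have h3 : (n / i : ℝ) ^ (δ * β) ≤ (n / i : ℝ) ^ (1 / 2 : ℝ) :=
          Real.rpow_le_rpow_of_exponent_le hni hδβ
        have h4 : (n / i : ℝ) ^ (1 / 2 : ℝ) =
            (n : ℝ) ^ (1 / 2 : ℝ) * (i : ℝ) ^ ((1 / 2 : ℝ) - 1) := by
          rw [Real.div_rpow (by positivity) (by positivity), div_eq_mul_inv,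
            ← Real.rpow_neg (by positivity)]
          norm_num
        rw [Real.rpow_neg hLi.le, Real.rpow_neg hLn.le]
        have h5 : Real.log ((n : ℝ) + 1) ^ β ≤ D ^ β * ((n : ℝ) ^ (1 / 2 : ℝ) *
            (i : ℝ) ^ ((1 / 2 : ℝ) - 1) * Real.log ((i : ℝ) + 1) ^ β) := by
          rw [← h4]
          exact h2.trans (by gcongr)
        rw [inv_le_iff_one_le_mul₀ (by positivity)]
        have h6 : 0 < Real.log ((n : ℝ) + 1) ^ β := by positivity
        calc 1 = Real.log ((n : ℝ) + 1) ^ β * (Real.log ((n : ℝ) + 1) ^ β)⁻¹ := by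
              rw [mul_inv_cancel₀ h6.ne']
          _ ≤ _ := mul_le_mul_of_nonneg_right h5 (by positivity)
          _ = _ := by ring
    _ ≤ (D ^ β * Real.log ((n : ℝ) + 1) ^ (-β) * (n : ℝ) ^ (1 / 2 : ℝ)) *
          (2 * (n : ℝ) ^ (1 / 2 : ℝ)) := by
        rw [← Finset.mul_sum]
        have hlog : 0 ≤ Real.log ((n : ℝ) + 1) :=
          Real.log_nonneg (by linarith [(Nat.cast_nonneg n : (0 : ℝ) ≤ n)])
        gcongr
        have := sum_rpow_sub_one_le (b := 1 / 2) (by norm_num) n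
        rwa [show (min 1 (1 / 2 : ℝ))⁻¹ = 2 by norm_num] at this
    _ = _ := by
        have : (n : ℝ) ^ (1 / 2 : ℝ) * (n : ℝ) ^ (1 / 2 : ℝ) = n := by
          rw [← Real.sqrt_eq_rpow, Real.mul_self_sqrt (Nat.cast_nonneg n)]
        linear_combination (2 * D ^ β * Real.log ((n : ℝ) + 1) ^ (-β)) * this

theorem volume_sum_abs_rpow_le {n : ℕ} (hn : 0 < n) {s R : ℝ} (hs : 0 < s) (hR : 0 < R) :
    volume {x : Fin n → ℝ | ∑ j, |x j| ^ s ≤ R} ≤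
      ENNReal.ofReal ((Real.exp 1 * (2 * ((n / R) ^ (-1 / s) * Real.Gamma (1 / s + 1)))) ^ n) := by
  have hn' : (0 : ℝ) < n := Nat.cast_pos.2 hn
  have hb : 0 < (n : ℝ) / R := by positivity
  set g : ℝ → ℝ := fun t => Real.exp (-(n / R) * |t| ^ s) with hg
  have hI : ∫ t, g t = 2 * ((n / R) ^ (-1 / s) * Real.Gamma (1 / s + 1)) := by
    rw [hg, integral_comp_abs (f := fun t => Real.exp (-(n / R) * t ^ s)),
      integral_exp_neg_mul_rpow hs hb]
  have hgam : 0 < Real.Gamma (1 / s + 1) := Real.Gamma_pos_of_pos (by positivity)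
  have hint : Integrable g := by
    by_contra h
    rw [integral_undef h] at hI
    have : 0 < 2 * (((n : ℝ) / R) ^ (-1 / s) * Real.Gamma (1 / s + 1)) := by positivity
    exact this.ne hI
  have hintp : Integrable (fun x : Fin n → ℝ => ∏ j, g (x j)) :=
    Integrable.fintype_prod fun _ => hint
  have hIp : ∫ x : Fin n → ℝ, ∏ j, g (x j) = (∫ t, g t) ^ n := by
    rw [integral_fintype_prod_volume_eq_pow, Fintype.card_fin]
  have hsub : {x : Fin n → ℝ | ∑ j, |x j| ^ s ≤ R} ⊆
      {x | ENNReal.ofReal (Real.exp (-n)) ≤ ENNReal.ofReal (∏ j, g (x j))} := by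
    intro x hx
    simp only [Set.mem_ofPred_eq] at hx ⊢
    refine ENNReal.ofReal_le_ofReal ?_
    rw [hg, ← Real.exp_sum, ← Finset.mul_sum]
    refine Real.exp_le_exp.2 ?_
    have : (n : ℝ) / R * ∑ j, |x j| ^ s ≤ n / R * R := by gcongr
    rw [div_mul_cancel₀ _ hR.ne'] at this
    linarith
  have hpos : 0 < ENNReal.ofReal (Real.exp (-n)) := ENNReal.ofReal_pos.2 (Real.exp_pos _)
  calc _ ≤ _ := measure_mono hsub
    _ ≤ (∫⁻ x : Fin n → ℝ, ENNReal.ofReal (∏ j, g (x j))) / ENNReal.ofReal (Real.exp (-n)) :=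
        meas_ge_le_lintegral_div hintp.aestronglyMeasurable.aemeasurable.ennreal_ofReal
          hpos.ne' ENNReal.ofReal_ne_top
    _ = ENNReal.ofReal ((Real.exp 1 * ∫ t, g t) ^ n) := by
        rw [← ofReal_integral_eq_lintegral_ofReal hintp
          (Filter.Eventually.of_forall fun x => Finset.prod_nonneg fun j _ => (Real.exp_pos _).le),
          hIp, ← ENNReal.ofReal_div_of_pos (Real.exp_pos _), Real.exp_neg, div_inv_eq_mul,
          mul_pow, ← Real.exp_nat_mul, mul_one, mul_comm]
    _ = _ := by rw [hI]

theorem card_le_of_separated {E : Type*} [NormedAddCommGroup E] [NormedSpace ℝ E]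
    [FiniteDimensional ℝ E] [Nontrivial E] {t : ℝ} (ht : 0 < t) (T : Finset E)
    (hT : ∀ x ∈ T, ‖x‖ ≤ 1) (hsep : ∀ x ∈ T, ∀ y ∈ T, x ≠ y → t < ‖x - y‖) :
    (T.card : ℝ) ≤ (1 + 2 / t) ^ Module.finrank ℝ E := by
  let _ : MeasurableSpace E := borel E
  have : BorelSpace E := ⟨rfl⟩
  set μ : Measure E := Measure.addHaar
  set d := Module.finrank ℝ E
  have hdisj : (T : Set E).PairwiseDisjoint (fun x => Metric.ball x (t / 2)) := by
    intro x hx y hy hxy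
    refine Metric.ball_disjoint_ball ?_
    rw [dist_eq_norm]
    linarith [hsep x hx y hy hxy]
  have hsub : (⋃ x ∈ T, Metric.ball x (t / 2)) ⊆ Metric.ball (0 : E) (1 + t / 2) := by
    refine Set.iUnion₂_subset fun x hx => Metric.ball_subset_ball' ?_
    rw [dist_zero_right]
    linarith [hT x hx]
  have h := measure_mono (μ := μ) hsub
  rw [measure_biUnion_finset hdisj fun x _ => measurableSet_ball,
    Finset.sum_congr rfl fun x _ => Measure.addHaar_ball μ x (by positivity : 0 ≤ t / 2),
    Measure.addHaar_ball μ 0 (by positivity : 0 ≤ 1 + t / 2), Finset.sum_const, nsmul_eq_mul,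
    ← mul_assoc, ENNReal.mul_le_mul_iff_left (Metric.measure_ball_pos μ 0 one_pos).ne'
      measure_ball_lt_top.ne, ← ENNReal.ofReal_natCast, ← ENNReal.ofReal_mul (by positivity),
    ENNReal.ofReal_le_ofReal_iff (by positivity)] at h
  have h2 : (1 + 2 / t) ^ d = (1 + t / 2) ^ d / (t / 2) ^ d := by
    rw [← div_pow]; congr 1; field_simp; ring
  rw [h2, le_div_iff₀ (by positivity)]
  exact h

theorem exists_cover_unit_ball {E : Type*} [NormedAddCommGroup E] [NormedSpace ℝ E]
    [FiniteDimensional ℝ E] [Nontrivial E] {t : ℝ} (ht : 0 < t) :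
    ∃ T : Finset E, (T.card : ℝ) ≤ (1 + 2 / t) ^ Module.finrank ℝ E ∧
      ∀ x : E, ‖x‖ ≤ 1 → ∃ y ∈ T, ‖x - y‖ ≤ t := by
  classical
  let S : Set ℕ := {m | ∃ T : Finset E, T.card = m ∧ (∀ x ∈ T, ‖x‖ ≤ 1) ∧
    ∀ x ∈ T, ∀ y ∈ T, x ≠ y → t < ‖x - y‖}
  have hne : S.Nonempty := ⟨0, ∅, by simp⟩
  have hbdd : BddAbove S := by
    refine ⟨⌊(1 + 2 / t) ^ Module.finrank ℝ E⌋₊, ?_⟩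
    rintro m ⟨T, rfl, h1, h2⟩
    exact Nat.le_floor (card_le_of_separated ht T h1 h2)
  obtain ⟨T, hcard, h1, h2⟩ := Nat.sSup_mem hne hbdd
  refine ⟨T, card_le_of_separated ht T h1 h2, fun x hx => ?_⟩
  by_contra! hcon
  have hxT : x ∉ T := fun h => by
    have := hcon x h
    rw [sub_self, norm_zero] at this
    linarith
  have : T.card + 1 ∈ S := by
    refine ⟨insert x T, Finset.card_insert_of_notMem hxT, ?_, ?_⟩
    · intro y hy
      rcases Finset.mem_insert.1 hy with rfl | hy
      exacts [hx, h1 y hy]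
    · intro y hy z hz hyz
      rcases Finset.mem_insert.1 hy with rfl | hy' <;> rcases Finset.mem_insert.1 hz with rfl | hz'
      · exact absurd rfl hyz
      · exact hcon z hz'
      · rw [norm_sub_rev]; exact hcon y hy'
      · exact h2 y hy' z hz' hyz
  have := le_csSup hbdd this
  omega

theorem exists_dyadic_cover_unit_ball {E : Type*} [NormedAddCommGroup E] [NormedSpace ℝ E]
    [FiniteDimensional ℝ E] [Nontrivial E] {k : ℕ} (hk : 0 < k) :
    ∃ T : Finset E, T.card ≤ 2 ^ (k - 1) ∧ ∀ x : E, ‖x‖ ≤ 1 → ∃ y ∈ T,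
      ‖x - y‖ ≤ 8 * (2 : ℝ) ^ (-(k : ℝ) / Module.finrank ℝ E) := by
  set d := Module.finrank ℝ E with hd
  have hd0 : 0 < d := Module.finrank_pos
  have hd1 : (1 : ℝ) ≤ d := by exact_mod_cast hd0
  set s : ℝ := (2 : ℝ) ^ (((k - 1 : ℕ) : ℝ) / d) with hs
  have hs0 : 0 < s := by positivity
  have hsd : s ^ d = 2 ^ (k - 1) := by
    rw [hs, ← Real.rpow_natCast, ← Real.rpow_mul (by norm_num),
      div_mul_cancel₀ _ (by positivity), Real.rpow_natCast]
  have hbound : 4 / s ≤ 8 * (2 : ℝ) ^ (-(k : ℝ) / d) := by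
    have h1 : (2 : ℝ) ^ (-(k : ℝ) / d) = (s * 2 ^ (1 / (d : ℝ)))⁻¹ := by
      rw [hs, ← Real.rpow_add (by norm_num), ← Real.rpow_neg (by norm_num), Nat.cast_sub hk]
      congr 1
      push_cast
      ring
    have h2 : (2 : ℝ) ^ (1 / (d : ℝ)) ≤ 2 := by
      conv_rhs => rw [← Real.rpow_one 2]
      exact Real.rpow_le_rpow_of_exponent_le (by norm_num) (by rw [div_le_one (by positivity)]; exact hd1)
    rw [h1, ← div_eq_mul_inv, div_le_div_iff₀ hs0 (by positivity)]
    nlinarith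
  rcases le_total s 2 with h | h
  · refine ⟨{0}, by simpa using Nat.one_le_two_pow, fun x hx => ⟨0, by simp, ?_⟩⟩
    rw [sub_zero]
    refine hx.trans (le_trans ?_ hbound)
    rw [le_div_iff₀ hs0]
    linarith
  · obtain ⟨T, hT, hcov⟩ := exists_cover_unit_ball (E := E) (t := 4 / s) (by positivity)
    refine ⟨T, ?_, fun x hx => ?_⟩
    · have h3 : (1 + 2 / (4 / s)) ^ d ≤ s ^ d := by
        refine pow_le_pow_left₀ (by positivity) ?_ _
        have : 2 / (4 / s) = s / 2 := by field_simp; norm_num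
        rw [this]; linarith
      rw [hsd] at h3
      exact_mod_cast hT.trans h3
    · obtain ⟨y, hy, hxy⟩ := hcov x hx
      exact ⟨y, hy, hxy.trans hbound⟩

theorem exists_dyadic_cover_of_sum_rpow {n k : ℕ} (hn : 0 < n) (hk : 0 < k) {r Λ : ℝ}
    (hr : 1 ≤ r) (hΛ : 0 < Λ) :
    ∃ T : Finset (Fin n → ℝ), T.card ≤ 2 ^ (k - 1) ∧
      ∀ x : Fin n → ℝ, ∑ j, |x j| ^ r ≤ Λ ^ r → ∃ y ∈ T,
        ∑ j, |(x - y) j| ^ r ≤ (Λ * (8 * (2 : ℝ) ^ (-(k : ℝ) / n))) ^ r := by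
  classical
  have hr0 : 0 < r := by linarith
  have : Fact (1 ≤ ENNReal.ofReal r) := ⟨by simpa using hr⟩
  have : Nonempty (Fin n) := ⟨⟨0, hn⟩⟩
  have htoReal : (ENNReal.ofReal r).toReal = r := ENNReal.toReal_ofReal hr0.le
  let E := PiLp (ENNReal.ofReal r) (fun _ : Fin n => ℝ)
  have hnorm (y : E) : ‖y‖ ^ r = ∑ j, |y.ofLp j| ^ r := by
    rw [PiLp.norm_eq_sum (by rw [htoReal]; exact hr0), htoReal, one_div,
      Real.rpow_inv_rpow (Finset.sum_nonneg fun _ _ => by positivity) hr0.ne']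
    simp only [Real.norm_eq_abs]
  have hle (y : E) {s : ℝ} (hs : 0 ≤ s) : ‖y‖ ≤ s ↔ ∑ j, |y.ofLp j| ^ r ≤ s ^ r := by
    rw [← hnorm, Real.rpow_le_rpow_iff (norm_nonneg _) hs hr0]
  have hdim : Module.finrank ℝ E = n := by
    rw [LinearEquiv.finrank_eq (WithLp.linearEquiv (ENNReal.ofReal r) ℝ (Fin n → ℝ)),
      Module.finrank_fin_fun]
  have : Nontrivial E := Module.nontrivial_of_finrank_pos (R := ℝ) (by rw [hdim]; exact hn)
  obtain ⟨T, hT, hcov⟩ := exists_dyadic_cover_unit_ball (E := E) hk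
  rw [hdim] at hcov
  refine ⟨T.image fun y => (Λ • y).ofLp, Finset.card_image_le.trans hT, fun x hx => ?_⟩
  have hx' : ‖Λ⁻¹ • (WithLp.toLp (ENNReal.ofReal r) x : E)‖ ≤ 1 := by
    rw [norm_smul, norm_inv, Real.norm_of_nonneg hΛ.le, inv_mul_le_one₀ hΛ, hle _ hΛ.le]
    exact hx
  obtain ⟨y, hy, hxy⟩ := hcov _ hx'
  refine ⟨_, Finset.mem_image_of_mem _ hy, ?_⟩
  have h1 : ‖(WithLp.toLp (ENNReal.ofReal r) x : E) - Λ • y‖ ≤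
      Λ * (8 * (2 : ℝ) ^ (-(k : ℝ) / n)) := by
    have : (WithLp.toLp (ENNReal.ofReal r) x : E) - Λ • y =
        Λ • (Λ⁻¹ • (WithLp.toLp (ENNReal.ofReal r) x : E) - y) := by
      rw [smul_sub, smul_inv_smul₀ hΛ.ne']
    rw [this, norm_smul, Real.norm_of_nonneg hΛ.le]
    gcongr
  rw [hle _ (by positivity)] at h1
  exact h1

theorem exists_cover_lorentz (q u v : ℝ≥0∞) (ha : 0 < (1 / q).toReal) (hu : 0 < u) (hv : 0 < v) :
    ∃ C : ℝ, 0 < C ∧ ∀ n k : ℕ, 0 < n → 0 < k →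
      ∃ T : Finset (Fin n → ℝ), T.card ≤ 2 ^ (k - 1) ∧
        ∀ x : Fin n → ℝ, lorentzNorm n ⊤ u x ≤ 1 → ∃ y ∈ T, lorentzNorm n q v (x - y) ≤
          C * ((2 : ℝ) ^ (-(k : ℝ) / (n : ℝ)) * (n : ℝ) ^ (1 / q).toReal *
            Real.log ((n : ℝ) + 1) ^ (-(1 / u).toReal)) := by
  set a := (1 / q).toReal with hadef
  set α := (1 / u).toReal with hα
  have hα0 : 0 ≤ α := ENNReal.toReal_nonneg
  set r : ℝ := 1 + 1 / a with hrdef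
  have hr : 1 ≤ r := by
    have : 0 < 1 / a := by positivity
    linarith
  have hr0 : 0 < r := by linarith
  have hγ : 1 / r < a := by
    rw [div_lt_iff₀ hr0, hrdef, mul_add, mul_one_div_cancel ha.ne']
    linarith
  obtain ⟨C₁, hC₁, hsum⟩ := exists_sum_log_rpow_le (β := α * r) (by positivity)
  obtain ⟨C₂, hC₂, hlor⟩ := exists_lorentzNorm_le_of_rpow_mul_rearr_le q v hv hγ
  refine ⟨C₂ * C₁ ^ (1 / r) * 8, by positivity, fun n k hn hk => ?_⟩
  have hn0 : (0 : ℝ) < n := by exact_mod_cast hn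
  have hL : 0 < Real.log ((n : ℝ) + 1) := Real.log_pos (by linarith)
  set L := Real.log ((n : ℝ) + 1)
  set Λ := (C₁ * n) ^ (1 / r) * L ^ (-α) with hΛdef
  have hΛ : 0 < Λ := by positivity
  have hΛr : Λ ^ r = C₁ * (n * L ^ (-(α * r))) := by
    rw [hΛdef, Real.mul_rpow (by positivity) (by positivity), ← Real.rpow_mul (by positivity),
      one_div_mul_cancel hr0.ne', Real.rpow_one, ← Real.rpow_mul hL.le, neg_mul, mul_assoc]
  obtain ⟨T, hT, hcov⟩ := exists_dyadic_cover_of_sum_rpow hn hk hr hΛ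
  refine ⟨T, hT, fun x hx => ?_⟩
  have hx' : ∑ j, |x j| ^ r ≤ Λ ^ r := by
    rw [hΛr, ← sum_rearr x (fun y => y ^ r)]
    refine (Finset.sum_le_sum fun i hi => ?_).trans (hsum n)
    have h1 := Real.rpow_le_rpow (rearr_nonneg n x i)
      (rearr_le_log_rpow_of_lorentzNorm_le_one hu hx hi) hr0.le
    have hi1 : (1 : ℝ) ≤ i := by exact_mod_cast (Finset.mem_Icc.1 hi).1
    rwa [← Real.rpow_mul (Real.log_nonneg (by linarith)), neg_mul] at h1
  obtain ⟨y, hy, hxy⟩ := hcov x hx'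
  refine ⟨y, hy, (hlor n (x - y) _ hn (by positivity) fun i hi =>
    rpow_mul_rearr_le_of_sum_rpow_le hr0 (by positivity) hxy hi).trans (le_of_eq ?_)⟩
  rw [hΛdef, Real.mul_rpow hC₁.le hn0.le]
  have : (n : ℝ) ^ a = (n : ℝ) ^ (a - 1 / r) * (n : ℝ) ^ (1 / r) := by
    rw [← Real.rpow_add hn0, sub_add_cancel]
  rw [← hadef, this]
  ring

theorem exists_le_of_cover_lorentz (q u v : ℝ≥0∞) (ha : 0 < (1 / q).toReal) (hu : 0 < u)
    (hv : 0 < v) :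
    ∃ c : ℝ, 0 < c ∧ ∀ n k : ℕ, 0 < n → 0 < k → ∀ ε : ℝ, 0 < ε → ∀ T : Finset (Fin n → ℝ),
      T.card ≤ 2 ^ (k - 1) →
      (∀ x : Fin n → ℝ, lorentzNorm n ⊤ u x ≤ 1 → ∃ y ∈ T, lorentzNorm n q v (x - y) ≤ ε) →
        c * ((2 : ℝ) ^ (-(k : ℝ) / (n : ℝ)) * (n : ℝ) ^ (1 / q).toReal *
            Real.log ((n : ℝ) + 1) ^ (-(1 / u).toReal)) ≤ ε := by
  obtain ⟨C, hC, hweak⟩ := exists_rpow_mul_rearr_le_lorentzNorm q v ha hv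
  set a := (1 / q).toReal with hadef
  set α := (1 / u).toReal with hα
  set s : ℝ := 1 / (2 * a) with hs
  have hs0 : 0 < s := by positivity
  have hG : 0 < Real.Gamma (1 / s + 1) := Real.Gamma_pos_of_pos (by positivity)
  set W : ℝ := Real.exp 1 * (2 * (2 ^ (1 / s) * C * Real.Gamma (1 / s + 1))) with hW
  have hW0 : 0 < W := by positivity
  refine ⟨2 * 3 ^ (-α) / W, by positivity, fun n k hn hk ε hε T hT hcov => ?_⟩
  have hn0 : (0 : ℝ) < n := by exact_mod_cast hn
  have hL : 0 < Real.log ((n : ℝ) + 1) := Real.log_pos (by linarith)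
  set L := Real.log ((n : ℝ) + 1) with hLdef
  set b : ℝ := (3 * L) ^ (-α) with hb
  have hb0 : 0 < b := by positivity
  set R : ℝ := 2 * (n : ℝ) ^ (1 / 2 : ℝ) * (C * ε) ^ s with hR
  have hR0 : 0 < R := by positivity
  set Z : Set (Fin n → ℝ) := {z | ∑ j, |z j| ^ s ≤ R} with hZ
  have hnR : ((n : ℝ) / R) ^ (-1 / s) = (n : ℝ) ^ (-a) * (2 ^ (1 / s) * (C * ε)) := by
    have h1 : (n : ℝ) / R = ((n : ℝ) ^ (-(1 / 2) : ℝ) * 2 * (C * ε) ^ s)⁻¹ := by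
      have h2 : (n : ℝ) ^ (1 / 2 : ℝ) * (n : ℝ) ^ (1 / 2 : ℝ) = n := by
        rw [← Real.sqrt_eq_rpow, Real.mul_self_sqrt hn0.le]
      have h3 : (0 : ℝ) < (n : ℝ) ^ (1 / 2 : ℝ) := by positivity
      rw [hR, Real.rpow_neg hn0.le]
      field_simp
      rw [sq, h2]
    rw [h1, neg_div, Real.inv_rpow (by positivity), ← Real.rpow_neg (by positivity), neg_neg,
      Real.mul_rpow (by positivity) (by positivity), Real.mul_rpow (by positivity) (by positivity),
      ← Real.rpow_mul hn0.le, ← Real.rpow_mul (by positivity : 0 ≤ C * ε),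
      mul_one_div_cancel hs0.ne', Real.rpow_one, mul_assoc,
      show -(1 / 2) * (1 / s) = -a by rw [hs]; field_simp]
  have hvol : volume Z ≤ ENNReal.ofReal ((W * (n : ℝ) ^ (-a) * ε) ^ n) := by
    refine (volume_sum_abs_rpow_le hn hs0 hR0).trans_eq ?_
    rw [hnR, hW]
    congr 2
    ring
  have hcube : Set.Icc (fun _ : Fin n => -b) (fun _ => b) ⊆ ⋃ y ∈ T, (fun x => x - y) ⁻¹' Z := by
    intro x hx
    have hx1 : lorentzNorm n ⊤ u x ≤ 1 :=
      lorentzNorm_le_one_of_forall_abs_le hu hn fun j => abs_le.2 ⟨hx.1 j, hx.2 j⟩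
    obtain ⟨y, hy, hxy⟩ := hcov x hx1
    refine Set.mem_iUnion₂.2 ⟨y, hy, ?_⟩
    exact sum_rpow_le_of_rpow_mul_rearr_le ha (by positivity) fun i hi =>
      (hweak n (x - y) i hi).trans (by gcongr)
  have hmeas := (measure_mono (μ := volume) hcube).trans (measure_biUnion_finset_le T _)
  have htrans (y : Fin n → ℝ) : volume ((fun x => x - y) ⁻¹' Z) = volume Z := by
    simp only [sub_eq_add_neg]
    exact measure_preimage_add_right volume (-y) Z
  rw [Finset.sum_congr rfl fun y _ => htrans y, Finset.sum_const, nsmul_eq_mul,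
    Real.volume_Icc_pi, Finset.prod_const, Finset.card_univ, Fintype.card_fin,
    ← ENNReal.ofReal_pow (by linarith)] at hmeas
  have hmeas2 := hmeas.trans (mul_le_mul_right hvol _)
  rw [← ENNReal.ofReal_natCast, ← ENNReal.ofReal_mul (by positivity),
    ENNReal.ofReal_le_ofReal_iff (by positivity)] at hmeas2
  set P : ℝ := (2 : ℝ) ^ ((k : ℝ) / n) with hP
  have hP0 : 0 < P := by positivity
  have hPn : P ^ n = 2 ^ k := by
    rw [hP, ← Real.rpow_natCast, ← Real.rpow_mul (by norm_num), div_mul_cancel₀ _ hn0.ne',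
      Real.rpow_natCast]
  have hTk : (T.card : ℝ) ≤ P ^ n := by
    rw [hPn]
    exact_mod_cast hT.trans (Nat.pow_le_pow_right (by norm_num) (Nat.sub_le _ _))
  have hfin : (b - -b) ^ n ≤ (P * (W * (n : ℝ) ^ (-a) * ε)) ^ n := by
    rw [mul_pow]
    exact hmeas2.trans (by gcongr)
  have hroot := (pow_le_pow_iff_left₀ (by linarith) (by positivity) hn.ne').1 hfin
  have hPinv : (2 : ℝ) ^ (-(k : ℝ) / n) = P⁻¹ := by
    rw [neg_div, Real.rpow_neg (by norm_num)]
  have hbeq : b = 3 ^ (-α) * L ^ (-α) := Real.mul_rpow (by norm_num) hL.le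
  have hna : (0 : ℝ) < (n : ℝ) ^ a := by positivity
  rw [hPinv]
  calc 2 * 3 ^ (-α) / W * (P⁻¹ * (n : ℝ) ^ a * L ^ (-α))
      = (b - -b) * (P⁻¹ * (n : ℝ) ^ a / W) := by rw [hbeq]; ring
    _ ≤ P * (W * (n : ℝ) ^ (-a) * ε) * (P⁻¹ * (n : ℝ) ^ a / W) := by gcongr
    _ = ε := by
        rw [Real.rpow_neg hn0.le]
        field_simp

/-- Case (I) of the main theorem: for `0 < q < ∞`, `p = ∞` and `0 < u, v ≤ ∞`,
`e_k(id : ℓ_{∞,u}^n → ℓ_{q,v}^n) ≍ 2^{-k/n} n^{1/q} (log(n+1))^{-1/u}` uniformly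
in `k` and `n`. -/
theorem entropy_lorentz_inftyu_qv
    (q u v : ℝ≥0∞) (hq : 0 < q) (hq' : q ≠ ⊤) (hu : 0 < u) (hv : 0 < v) :
    ∃ c C : ℝ, 0 < c ∧ 0 < C ∧ ∀ n k : ℕ, 0 < n → 0 < k →
      c * ((2 : ℝ) ^ (-(k : ℝ) / (n : ℝ)) * (n : ℝ) ^ (1 / q).toReal *
            Real.log ((n : ℝ) + 1) ^ (-(1 / u).toReal)) ≤
          entropyNumber n (lorentzNorm n ⊤ u) (lorentzNorm n q v) k ∧
        entropyNumber n (lorentzNorm n ⊤ u) (lorentzNorm n q v) k ≤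
          C * ((2 : ℝ) ^ (-(k : ℝ) / (n : ℝ)) * (n : ℝ) ^ (1 / q).toReal *
            Real.log ((n : ℝ) + 1) ^ (-(1 / u).toReal)) := by
  have ha : 0 < (1 / q).toReal := by
    rw [ENNReal.toReal_div, ENNReal.toReal_one]
    exact one_div_pos.2 (ENNReal.toReal_pos hq.ne' hq')
  obtain ⟨C, hC, hupper⟩ := exists_cover_lorentz q u v ha hu hv
  obtain ⟨c, hc, hlower⟩ := exists_le_of_cover_lorentz q u v ha hu hv
  refine ⟨c, C, hc, hC, fun n k hn hk => ?_⟩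
  have hn0 : (0 : ℝ) < n := by exact_mod_cast hn
  have hL : 0 < Real.log ((n : ℝ) + 1) := Real.log_pos (by linarith)
  obtain ⟨T, hT, hcov⟩ := hupper n k hn hk
  have hmem : C * ((2 : ℝ) ^ (-(k : ℝ) / (n : ℝ)) * (n : ℝ) ^ (1 / q).toReal *
      Real.log ((n : ℝ) + 1) ^ (-(1 / u).toReal)) ∈ {ε : ℝ | 0 < ε ∧
        ∃ T : Finset (Fin n → ℝ), T.card ≤ 2 ^ (k - 1) ∧ ∀ x : Fin n → ℝ,
          lorentzNorm n ⊤ u x ≤ 1 → ∃ y ∈ T, lorentzNorm n q v (x - y) ≤ ε} :=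
    ⟨by positivity, T, hT, hcov⟩
  exact ⟨le_csInf ⟨_, hmem⟩ fun ε ⟨hε, T, hT, hcov⟩ => hlower n k hn hk ε hε T hT hcov,
    csInf_le ⟨0, fun ε hε => hε.1.le⟩ hmem⟩
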